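/- Let p ∈ ℂ[x] be nonzero with n = deg p and c ∈ ℂ such that p(x) = (−1)^n p(−x + c). Let a ∈ (𝒟_p^±)_{−1} be nonzero, and define the subspaces 𝔭^a_{−1} := span_ℂ of all iterated brackets [⋯[[a, x₁], x₂], …, x_r] with r ≥ 0 and x₁, …, x_r ∈ (𝒟_p^±)_0, and inductively 𝔭^a_{−k−1} := span_ℂ[𝔭^a_{−1}, 𝔭^a_{−k}] for k ≥ 1. Then for every j ≥ 1 the subspace 𝔭^a_{−j} has finite codimension in (𝒟_p^±)_{−j}; that is, every nonzero element of (𝒟_p^±)_{−1} is nondegenerate. -/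

import Mathlib

noncomputable section

/-- ℂ[t,t⁻¹] as a ℂ-vector space with basis {t^j}_{j∈ℤ}; t^j is `Finsupp.single j 1`. -/
abbrev LaurentV : Type := ℤ →₀ ℂ

/-- The regular differential operator `t^k f(D)` (where D = t·d/dt), acting by
t^j ↦ f(j)·t^{j+k}. -/
def op (k : ℤ) (f : Polynomial ℂ) : Module.End ℂ LaurentV :=
  Finsupp.lsum ℂ fun j => f.eval (j : ℂ) • Finsupp.lsingle (j + k)

/-- The graded piece (𝒟ᵃ_p)_j = {t^j f(D) p(D) : f ∈ ℂ[x]}. -/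
def Dgrade (p : Polynomial ℂ) (j : ℤ) : Submodule ℂ (Module.End ℂ LaurentV) :=
  Submodule.span ℂ {A | ∃ f : Polynomial ℂ, A = op j (f * p)}

/-- 𝒟ᵃ_p = 𝒟ᵃ·p(D). -/
def Dp (p : Polynomial ℂ) : Submodule ℂ (Module.End ℂ LaurentV) :=
  Submodule.span ℂ {A | ∃ (k : ℤ) (f : Polynomial ℂ), A = op k (f * p)}

/-- σ is an anti-involution: it is ℂ-linear (built into the type), involutive, and
reverses products. -/
def IsAntiInvolutionOn (p : Polynomial ℂ) (σ : ↥(Dp p) →ₗ[ℂ] ↥(Dp p)) : Prop :=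
  (∀ A : ↥(Dp p), σ (σ A) = A) ∧
  (∀ A B W : ↥(Dp p),
    (W : Module.End ℂ LaurentV) = (A : Module.End ℂ LaurentV) * (B : Module.End ℂ LaurentV) →
    ((σ W : Module.End ℂ LaurentV)) = (σ B : Module.End ℂ LaurentV) * (σ A : Module.End ℂ LaurentV))

/-- σ preserves the principal ℤ-gradation. -/
def PreservesGrading (p : Polynomial ℂ) (σ : ↥(Dp p) →ₗ[ℂ] ↥(Dp p)) : Prop :=
  ∀ (j : ℤ) (A : ↥(Dp p)), (A : Module.End ℂ LaurentV) ∈ Dgrade p j →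
    ((σ A : Module.End ℂ LaurentV)) ∈ Dgrade p j

/-- σ(t^k f(D) p(D)) = (-1)^{deg p}·e^k·t^k f(−D−k+c)p(D). -/
def SigmaFormula (p : Polynomial ℂ) (c e : ℂ) (σ : ↥(Dp p) →ₗ[ℂ] ↥(Dp p)) : Prop :=
  ∀ (k : ℤ) (f : Polynomial ℂ) (A : ↥(Dp p)), (A : Module.End ℂ LaurentV) = op k (f * p) →
    ((σ A : Module.End ℂ LaurentV)) =
      ((-1 : ℂ) ^ p.natDegree * e ^ k) •
        op k ((f.comp (Polynomial.C (c - (k : ℂ)) - Polynomial.X)) * p)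

/-- The graded piece (𝒟_p^±)_k = {d ∈ (𝒟_p)_k : σ_±(d) = −d}, as a set. -/
def DpmGradeSet (p : Polynomial ℂ) (c e : ℂ) (k : ℤ) : Set (Module.End ℂ LaurentV) :=
  {A | ∃ f : Polynomial ℂ, A = op k (f * p) ∧
    ((-1 : ℂ) ^ p.natDegree * e ^ k) •
      op k ((f.comp (Polynomial.C (c - (k : ℂ)) - Polynomial.X)) * p) = -A}

/-- The graded piece (𝒟_p^±)_k, as a ℂ-subspace. -/
def DpmGrade (p : Polynomial ℂ) (c e : ℂ) (k : ℤ) : Submodule ℂ (Module.End ℂ LaurentV) :=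
  Submodule.span ℂ (DpmGradeSet p c e k)

/-- V has finite codimension in W. -/
def FinCodimIn {M : Type*} [AddCommGroup M] [Module ℂ M] (V W : Submodule ℂ M) : Prop :=
  FiniteDimensional ℂ (↥W ⧸ Submodule.comap W.subtype V)


/-- Iterated brackets [⋯[[a,x₁],x₂],…,x_r] with all x_i in G. -/
inductive IterBracket (G : Submodule ℂ (Module.End ℂ LaurentV)) (a : Module.End ℂ LaurentV) :
    Module.End ℂ LaurentV → Prop
  | base : IterBracket G a a
  | step (x y : Module.End ℂ LaurentV) :
      IterBracket G a x → y ∈ G → IterBracket G a ⁅x, y⁆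

/-- 𝔭^a_{-1} = span of all iterated brackets of a with (𝒟_p^±)_0. -/
def paOne (p : Polynomial ℂ) (c e : ℂ) (a : Module.End ℂ LaurentV) :
    Submodule ℂ (Module.End ℂ LaurentV) :=
  Submodule.span ℂ {x | IterBracket (DpmGrade p c e 0) a x}

/-- `paNeg p c e a j` is 𝔭^a_{-(j+1)}; 𝔭^a_{-k-1} = [𝔭^a_{-1}, 𝔭^a_{-k}]. -/
def paNeg (p : Polynomial ℂ) (c e : ℂ) (a : Module.End ℂ LaurentV) :
    ℕ → Submodule ℂ (Module.End ℂ LaurentV)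
  | 0 => paOne p c e a
  | (j + 1) => Submodule.span ℂ
      {z | ∃ x ∈ paOne p c e a, ∃ y ∈ paNeg p c e a j, z = ⁅x, y⁆}

open Polynomial in
lemma op_single (k j : ℤ) (f : ℂ[X]) (z : ℂ) :
    op k f (Finsupp.single j z) = Finsupp.single (j + k) (f.eval (j : ℂ) * z) := by
  simp [op]

open Polynomial in
lemma op_injective (k : ℤ) : Function.Injective (op k) := by
  intro f g hfg
  have hev : ∀ j : ℤ, f.eval (j : ℂ) = g.eval (j : ℂ) := fun j => by
    have h := congrArg (fun A : Module.End ℂ LaurentV => A (Finsupp.single j 1) (j + k)) hfg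
    simpa [op_single] using h
  refine Polynomial.eq_of_infinite_eval_eq f g ?_
  refine (Set.infinite_range_of_injective (Int.cast_injective (α := ℂ))).mono ?_
  rintro _ ⟨j, rfl⟩
  exact hev j

open Polynomial in
/-- The linear map `f ↦ t^k f(D) p(D)`. -/
def opMul (p : ℂ[X]) (k : ℤ) : ℂ[X] →ₗ[ℂ] Module.End ℂ LaurentV where
  toFun f := op k (f * p)
  map_add' f g := by
    refine Finsupp.lhom_ext fun j z => ?_
    simp only [LinearMap.add_apply, op_single, ← Finsupp.single_add, add_mul, eval_add]
  map_smul' s f := by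
    refine Finsupp.lhom_ext fun j z => ?_
    simp only [LinearMap.smul_apply, op_single, RingHom.id_apply, smul_mul_assoc, eval_smul,
      Finsupp.smul_single, smul_eq_mul, mul_assoc]

open Polynomial in
lemma opMul_apply (p f : ℂ[X]) (k : ℤ) : opMul p k f = op k (f * p) := rfl

open Polynomial in
lemma opMul_injective {p : ℂ[X]} (hp : p ≠ 0) (k : ℤ) : Function.Injective (opMul p k) :=
  fun _ _ h => mul_right_cancel₀ hp (op_injective k h)

open Polynomial in
lemma op_lie_op (k l : ℤ) (f g : ℂ[X]) :
    ⁅op k f, op l g⁆ = op (k + l) (taylor (l : ℂ) f * g - taylor (k : ℂ) g * f) := by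
  refine Finsupp.lhom_ext fun j z => ?_
  simp only [Ring.lie_def, LinearMap.sub_apply, Module.End.mul_apply, op_single, eval_sub,
    eval_mul, taylor_eval, Int.cast_add]
  rw [show j + l + k = j + (k + l) by ring, show j + k + l = j + (k + l) by ring,
    ← Finsupp.single_sub]
  congr 1
  ring

/-- The sign `(-1)^{deg p} e^k` in the formula for the anti-involution. -/
def gradeSign (p : Polynomial ℂ) (e : ℂ) (k : ℤ) : ℂ := (-1) ^ p.natDegree * e ^ k

lemma gradeSign_add (p : Polynomial ℂ) {e : ℂ} (he : e ≠ 0) (k l : ℤ) :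
    gradeSign p e (k + l) = (-1) ^ p.natDegree * gradeSign p e k * gradeSign p e l := by
  have h : ((-1 : ℂ) ^ p.natDegree) * (-1) ^ p.natDegree = 1 := by
    rw [← mul_pow]; norm_num
  rw [gradeSign, gradeSign, gradeSign, zpow_add₀ he]
  linear_combination (-(-1) ^ p.natDegree * e ^ k * e ^ l) * h

lemma gradeSign_eq (p : Polynomial ℂ) {e : ℂ} (he : e = 1 ∨ e = -1) (k : ℤ) :
    gradeSign p e k = 1 ∨ gradeSign p e k = -1 := by
  have h1 := neg_one_pow_eq_or ℂ p.natDegree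
  have h2 : e ^ k = 1 ∨ e ^ k = -1 := by
    rcases he with rfl | rfl
    · simp
    · rcases Int.even_or_odd k with h | h
      · exact Or.inl h.neg_one_zpow
      · exact Or.inr h.neg_one_zpow
  rcases h1 with h1 | h1 <;> rcases h2 with h2 | h2 <;> simp [gradeSign, h1, h2]

lemma gradeSign_mul_self (p : Polynomial ℂ) {e : ℂ} (he : e = 1 ∨ e = -1) (k : ℤ) :
    gradeSign p e k * gradeSign p e k = 1 := by
  rcases gradeSign_eq p he k with h | h <;> simp [h]

open Polynomial in
/-- The polynomials `f` such that `t^k f(D) p(D)` is anti-invariant under the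
anti-involution. -/
def skewPoly (p : ℂ[X]) (c e : ℂ) (k : ℤ) : Submodule ℂ ℂ[X] where
  carrier := {f | ∀ x, gradeSign p e k * f.eval (c - k - x) = -f.eval x}
  zero_mem' := by simp
  add_mem' {f g} hf hg x := by
    simp only [eval_add]
    linear_combination hf x + hg x
  smul_mem' s f hf x := by
    simp only [eval_smul, smul_eq_mul]
    linear_combination s * hf x

open Polynomial in
lemma mem_skewPoly {p : ℂ[X]} {c e : ℂ} {k : ℤ} {f : ℂ[X]} :
    f ∈ skewPoly p c e k ↔ ∀ x, gradeSign p e k * f.eval (c - k - x) = -f.eval x := Iff.rfl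

open Polynomial in
lemma DpmGrade_eq_map {p : ℂ[X]} (hp : p ≠ 0) (c e : ℂ) (k : ℤ) :
    DpmGrade p c e k = (skewPoly p c e k).map (opMul p k) := by
  have key : DpmGradeSet p c e k = (skewPoly p c e k).map (opMul p k) := by
    ext A
    simp only [DpmGradeSet, Set.mem_ofPred_eq, SetLike.mem_coe, Submodule.mem_map,
      ← opMul_apply, ← map_smul]
    refine exists_congr fun f => ?_
    rw [and_comm, eq_comm (a := A)]
    refine and_congr_left fun hA => ?_
    have hneg : -opMul p k f = opMul p k (-f) := by
      refine Finsupp.lhom_ext fun j z => ?_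
      simp only [LinearMap.neg_apply, opMul_apply, op_single, neg_mul, eval_neg,
        Finsupp.single_neg]
    rw [← hA, hneg, (opMul_injective hp k).eq_iff, mem_skewPoly]
    constructor
    · intro h x
      have := congrArg (eval x) h
      simpa [gradeSign] using this
    · intro h
      refine Polynomial.funext fun x => ?_
      simpa [gradeSign] using h x
  rw [DpmGrade, key, Submodule.span_eq]

open Polynomial in
lemma neg_one_pow_natDegree_of_mem_skewPoly {p : ℂ[X]} {c e : ℂ} (he : e = 1 ∨ e = -1) {k : ℤ}
    {f : ℂ[X]} (hf : f ∈ skewPoly p c e k) (hf0 : f ≠ 0) :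
    (-1 : ℂ) ^ f.natDegree = -gradeSign p e k := by
  have hcomp : C (gradeSign p e k) * f.comp (C (c - k) - X) = -f :=
    Polynomial.funext fun x => by simpa using hf x
  have hd : (C (c - k) - X : ℂ[X]).natDegree = 1 := by
    rw [← natDegree_neg, neg_sub, natDegree_X_sub_C]
  have hl : (C (c - k) - X : ℂ[X]).leadingCoeff = -1 := by
    rw [← neg_sub, leadingCoeff_neg, leadingCoeff_X_sub_C]
  have h := congrArg leadingCoeff hcomp
  rw [leadingCoeff_mul, leadingCoeff_C, leadingCoeff_comp (by rw [hd]; exact one_ne_zero), hl,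
    leadingCoeff_neg] at h
  have h2 := gradeSign_mul_self p he k
  refine mul_left_cancel₀ (leadingCoeff_ne_zero.2 hf0) ?_
  linear_combination gradeSign p e k * h - f.leadingCoeff * (-1) ^ f.natDegree * h2

open Polynomial in
/-- The polynomial `h` with `[t^k f(D) p(D), t^l g(D) p(D)] = t^{k+l} h(D) p(D)`. -/
def lieSymbol (p : ℂ[X]) (k l : ℤ) (f g : ℂ[X]) : ℂ[X] :=
  taylor (l : ℂ) (f * p) * g - taylor (k : ℂ) (g * p) * f

open Polynomial in
lemma opMul_lie_opMul (p f g : ℂ[X]) (k l : ℤ) :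
    ⁅opMul p k f, opMul p l g⁆ = opMul p (k + l) (lieSymbol p k l f g) := by
  simp only [opMul_apply, op_lie_op, lieSymbol]
  congr 1
  ring

open Polynomial in
lemma lieSymbol_mem_skewPoly {p : ℂ[X]} {c e : ℂ} (he : e ≠ 0)
    (hpc : ∀ x : ℂ, p.eval x = (-1 : ℂ) ^ p.natDegree * p.eval (-x + c)) {k l : ℤ} {f g : ℂ[X]}
    (hf : f ∈ skewPoly p c e k) (hg : g ∈ skewPoly p c e l) :
    lieSymbol p k l f g ∈ skewPoly p c e (k + l) := by
  intro x
  have hk := hf x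
  have hkl := hf (x + l)
  have hl := hg x
  have hlk := hg (x + k)
  have hpk := hpc (c - k - x)
  have hpl := hpc (c - l - x)
  rw [show -(c - k - x) + c = x + k by ring] at hpk
  rw [show -(c - l - x) + c = x + l by ring] at hpl
  rw [show c - k - (x + l) = c - k - l - x by ring] at hkl
  rw [show c - l - (x + k) = c - k - l - x by ring] at hlk
  have hsq : ((-1 : ℂ) ^ p.natDegree) * (-1) ^ p.natDegree = 1 := by
    rw [← mul_pow]; norm_num
  simp only [lieSymbol, eval_sub, eval_mul, taylor_eval, gradeSign_add p he, Int.cast_add]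
  rw [show c - (k + l : ℂ) - x + l = c - k - x by ring,
    show c - (k + l : ℂ) - x + k = c - l - x by ring,
    show c - (k + l : ℂ) - x = c - k - l - x by ring, hpk, hpl]
  generalize (-1 : ℂ) ^ p.natDegree = s at *
  generalize gradeSign p e k = a at *
  generalize gradeSign p e l = b at *
  generalize eval (c - k - x) f = f1 at *
  generalize eval (c - k - l - x) f = f2 at *
  generalize eval (c - l - x) g = g1 at *
  generalize eval (c - k - l - x) g = g2 at *
  generalize eval (x + k) p = P at *
  generalize eval (x + l) p = Q at *
  calc s * a * b * (f1 * (s * P) * g2 - g1 * (s * Q) * f2)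
      = s * s * ((a * f1) * P * (b * g2) - (b * g1) * Q * (a * f2)) := by ring
    _ = _ := by rw [hsq, hk, hlk, hl, hkl]; ring

open Polynomial in
lemma coeff_taylor_sub_self {F : ℂ[X]} {i : ℕ} (hF : F.natDegree ≤ i + 1) (r : ℂ) :
    (taylor r F - F).coeff i = r * (i + 1) * F.coeff (i + 1) := by
  have hd : (hasseDeriv i F).natDegree < 2 :=
    lt_of_le_of_lt (natDegree_hasseDeriv_le F i) (by omega)
  rw [coeff_sub, taylor_coeff, eval_eq_sum_range' hd]
  simp only [Finset.sum_range_succ, Finset.sum_range_zero, hasseDeriv_coeff, zero_add,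
    Nat.choose_self, pow_zero, pow_one, add_comm 1 i, Nat.choose_succ_self_right]
  push_cast
  ring

open Polynomial in
lemma natDegree_X_mul_taylor_sub_self_le (F : ℂ[X]) (r : ℂ) :
    (X * (taylor r F - F)).natDegree ≤ F.natDegree := by
  refine natDegree_le_iff_coeff_eq_zero.2 fun N hN => ?_
  obtain ⟨i, rfl⟩ : ∃ i, N = i + 1 := ⟨N - 1, by omega⟩
  rw [coeff_X_mul, coeff_taylor_sub_self (by omega), coeff_eq_zero_of_natDegree_lt hN, mul_zero]

open Polynomial in
lemma coeff_X_mul_taylor_sub_self (F : ℂ[X]) (r : ℂ) :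
    (X * (taylor r F - F)).coeff F.natDegree = r * F.natDegree * F.leadingCoeff := by
  rcases h : F.natDegree with _ | i
  · simp
  · rw [coeff_X_mul, coeff_taylor_sub_self h.le, leadingCoeff, h]
    push_cast
    ring

open Polynomial in
lemma natDegree_taylor_mul_sub_taylor_mul {F G : ℂ[X]} (hF : F ≠ 0) (hG : G ≠ 0) (k l : ℤ)
    (h : l * (F.natDegree : ℤ) ≠ k * (G.natDegree : ℤ)) :
    taylor (l : ℂ) F * G - taylor (k : ℂ) G * F ≠ 0 ∧
      (taylor (l : ℂ) F * G - taylor (k : ℂ) G * F).natDegree + 1 =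
        F.natDegree + G.natDegree := by
  set H := taylor (l : ℂ) F * G - taylor (k : ℂ) G * F
  have hH : X * H = X * (taylor (l : ℂ) F - F) * G - F * (X * (taylor (k : ℂ) G - G)) := by
    simp only [H]
    ring
  have hcoeff : (X * H).coeff (F.natDegree + G.natDegree) =
      ((l * F.natDegree - k * G.natDegree : ℤ) : ℂ) * (F.leadingCoeff * G.leadingCoeff) := by
    rw [hH, coeff_sub,
      coeff_mul_add_eq_of_natDegree_le (natDegree_X_mul_taylor_sub_self_le F _) le_rfl,
      coeff_mul_add_eq_of_natDegree_le le_rfl (natDegree_X_mul_taylor_sub_self_le G _),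
      coeff_X_mul_taylor_sub_self, coeff_X_mul_taylor_sub_self, coeff_natDegree, coeff_natDegree]
    push_cast
    ring
  have hne : (X * H).coeff (F.natDegree + G.natDegree) ≠ 0 := by
    rw [hcoeff]
    refine mul_ne_zero (Int.cast_ne_zero.2 (sub_ne_zero.2 h))
      (mul_ne_zero (leadingCoeff_ne_zero.2 hF) (leadingCoeff_ne_zero.2 hG))
  have hH0 : H ≠ 0 := by
    intro h0
    simp [h0] at hne
  refine ⟨hH0, ?_⟩
  rw [← natDegree_X_mul hH0]
  refine le_antisymm ?_ (le_natDegree_of_ne_zero hne)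
  rw [hH]
  refine (natDegree_sub_le _ _).trans (max_le ?_ ?_)
  · exact natDegree_mul_le.trans (Nat.add_le_add_right (natDegree_X_mul_taylor_sub_self_le F _) _)
  · exact natDegree_mul_le.trans (Nat.add_le_add_left (natDegree_X_mul_taylor_sub_self_le G _) _)

open Polynomial in
lemma natDegree_lieSymbol {p f g : ℂ[X]} (hp : p ≠ 0) (hf : f ≠ 0) (hg : g ≠ 0) (k l : ℤ)
    (h : l * ((f.natDegree + p.natDegree : ℕ) : ℤ) ≠ k * ((g.natDegree + p.natDegree : ℕ) : ℤ)) :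
    lieSymbol p k l f g ≠ 0 ∧
      (lieSymbol p k l f g).natDegree + 1 = f.natDegree + g.natDegree + p.natDegree := by
  have hmul : lieSymbol p k l f g * p =
      taylor (l : ℂ) (f * p) * (g * p) - taylor (k : ℂ) (g * p) * (f * p) := by
    rw [lieSymbol]
    ring
  obtain ⟨h0, hdeg⟩ := natDegree_taylor_mul_sub_taylor_mul (mul_ne_zero hf hp) (mul_ne_zero hg hp)
    k l (by rwa [natDegree_mul hf hp, natDegree_mul hg hp])
  rw [← hmul] at h0 hdeg
  have hL := left_ne_zero_of_mul h0
  rw [natDegree_mul hL hp, natDegree_mul hf hp, natDegree_mul hg hp] at hdeg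
  exact ⟨hL, by omega⟩

lemma finCodimIn_of_le_sup {M : Type*} [AddCommGroup M] [Module ℂ M] {V W F : Submodule ℂ M}
    [Module.Finite ℂ F] (hle : W ≤ V ⊔ F) : FinCodimIn V W := by
  set φ := V.mkQ.comp W.subtype
  have hφ : Submodule.comap W.subtype V = LinearMap.ker φ := by
    rw [LinearMap.ker_comp, Submodule.ker_mkQ]
  have hrange : LinearMap.range φ ≤ F.map V.mkQ := by
    rintro _ ⟨w, rfl⟩
    obtain ⟨v, hv, y, hy, hw⟩ := Submodule.mem_sup.1 (hle w.2)
    refine ⟨y, hy, ?_⟩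
    simp only [φ, LinearMap.comp_apply, Submodule.subtype_apply, ← hw, map_add]
    rw [show V.mkQ v = 0 by simpa using hv, zero_add]
  have : Module.Finite ℂ (F.map V.mkQ) := Module.Finite.map _ _
  have : FiniteDimensional ℂ (LinearMap.range φ) := Submodule.finiteDimensional_of_le hrange
  rw [FinCodimIn, hφ]
  exact Module.Finite.equiv φ.quotKerEquivRange.symm

open Polynomial in
/-- `V` contains anti-invariant operators of degree `k` and of every sufficiently large order of
the admissible parity. -/
def HasLargeDegrees (p : ℂ[X]) (c e : ℂ) (k : ℤ) (V : Submodule ℂ (Module.End ℂ LaurentV)) :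
    Prop :=
  ∃ N : ℕ, ∀ d ≥ N, (-1 : ℂ) ^ d = -gradeSign p e k →
    ∃ h ∈ skewPoly p c e k, h ≠ 0 ∧ h.natDegree = d ∧ opMul p k h ∈ V

open Polynomial in
lemma HasLargeDegrees.finCodimIn {p : ℂ[X]} (hp : p ≠ 0) {c e : ℂ} (he : e = 1 ∨ e = -1) {k : ℤ}
    {V : Submodule ℂ (Module.End ℂ LaurentV)} (hV : HasLargeDegrees p c e k V) :
    FinCodimIn (M := Module.End ℂ LaurentV) V (DpmGrade p c e k) := by
  obtain ⟨N, hN⟩ := hV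
  set F : Submodule ℂ (Module.End ℂ LaurentV) := (degreeLT ℂ N).map (opMul p k)
  have : Module.Finite ℂ (degreeLT ℂ N) := Module.Finite.equiv (degreeLTEquiv ℂ N).symm
  have : Module.Finite ℂ F := Module.Finite.map _ _
  have hred : ∀ n : ℕ, ∀ f ∈ skewPoly p c e k, f.degree < n → opMul p k f ∈ V ⊔ F := by
    intro n
    induction n with
    | zero =>
      intro f _ hdeg
      have : f = 0 := by
        rw [← degree_eq_bot]
        simpa using hdeg
      simp [this]
    | succ n ih =>
      intro f hf hdeg
      by_cases hn : f.degree < n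
      · exact ih f hf hn
      have hfn : f.degree = n :=
        le_antisymm (Order.lt_succ_iff.1 hdeg) (not_lt.1 hn)
      have hf0 : f ≠ 0 := by
        rintro rfl
        simp at hfn
      by_cases hnN : n < N
      · refine Submodule.mem_sup_right (Submodule.mem_map_of_mem (mem_degreeLT.2 ?_))
        rw [hfn]
        exact_mod_cast hnN
      have hnat : f.natDegree = n := natDegree_eq_of_degree_eq_some hfn
      obtain ⟨h, hh, hh0, hhn, hhV⟩ := hN n (not_lt.1 hnN)
        (hnat ▸ neg_one_pow_natDegree_of_mem_skewPoly he hf hf0)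
      set s := f.leadingCoeff / h.leadingCoeff
      have hlc := leadingCoeff_ne_zero.2 hh0
      have hs : s ≠ 0 := div_ne_zero (leadingCoeff_ne_zero.2 hf0) hlc
      have hlt : (f - s • h).degree < f.degree := by
        refine degree_sub_lt_left ?_ hf0 ?_
        · rw [degree_smul_of_smul_regular _ (IsSMulRegular.of_ne_zero hs), hfn,
            degree_eq_natDegree hh0, hhn]
        · rw [smul_eq_C_mul, leadingCoeff_mul, leadingCoeff_C]
          exact (div_mul_cancel₀ _ hlc).symm
      have hsub := ih (f - s • h) (sub_mem hf (Submodule.smul_mem _ s hh)) (hfn ▸ hlt)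
      have := add_mem hsub (Submodule.mem_sup_left (T := F) (Submodule.smul_mem V s hhV))
      rwa [← map_smul, ← map_add, sub_add_cancel] at this
  have hle : DpmGrade p c e k ≤ V ⊔ F := by
    rw [DpmGrade_eq_map hp]
    rintro _ ⟨f, hf, rfl⟩
    refine hred (f.natDegree + 1) f hf ?_
    exact degree_le_natDegree.trans_lt (by exact_mod_cast Nat.lt_succ_self _)
  exact finCodimIn_of_le_sup hle

open Polynomial in
lemma HasLargeDegrees.exists_ne_zero {p : ℂ[X]} {c e : ℂ} (he : e = 1 ∨ e = -1) {k : ℤ}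
    {V : Submodule ℂ (Module.End ℂ LaurentV)} (hV : HasLargeDegrees p c e k V) :
    ∃ h ∈ skewPoly p c e k, h ≠ 0 ∧ opMul p k h ∈ V := by
  obtain ⟨N, hN⟩ := hV
  obtain ⟨d, hd, hsign⟩ : ∃ d ≥ N, (-1 : ℂ) ^ d = -gradeSign p e k := by
    rcases gradeSign_eq p he k with h | h
    · exact ⟨2 * N + 1, by omega, by rw [h, pow_succ, pow_mul]; norm_num⟩
    · exact ⟨2 * N, by omega, by rw [h, pow_mul]; norm_num⟩
  obtain ⟨h, hh, hh0, -, hhV⟩ := hN d hd hsign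
  exact ⟨h, hh, hh0, hhV⟩

open Polynomial in
lemma HasLargeDegrees.lie {p : ℂ[X]} (hp : p ≠ 0) {c e : ℂ} (he : e = 1 ∨ e = -1)
    (hpc : ∀ x : ℂ, p.eval x = (-1 : ℂ) ^ p.natDegree * p.eval (-x + c)) {k l : ℤ}
    (hk : k ≠ 0) {f : ℂ[X]} (hf : f ∈ skewPoly p c e k) (hf0 : f ≠ 0)
    {V W : Submodule ℂ (Module.End ℂ LaurentV)} (hV : HasLargeDegrees p c e l V)
    (hVW : ∀ y ∈ V, ⁅opMul p k f, y⁆ ∈ W) : HasLargeDegrees p c e (k + l) W := by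
  have he0 : e ≠ 0 := by rcases he with rfl | rfl <;> norm_num
  obtain ⟨N, hN⟩ := hV
  set r := f.natDegree + p.natDegree
  refine ⟨N + r + l.natAbs * r + 1, fun d hd hsign => ?_⟩
  obtain ⟨m, hm⟩ : ∃ m, d + 1 = m + r := ⟨d + 1 - r, by omega⟩
  have hmsign : (-1 : ℂ) ^ m = -gradeSign p e l := by
    have hr : (-1 : ℂ) ^ r = -gradeSign p e k * (-1) ^ p.natDegree := by
      rw [pow_add, neg_one_pow_natDegree_of_mem_skewPoly he hf hf0]
    have h := pow_add (-1 : ℂ) m r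
    rw [← hm, pow_succ, hsign, gradeSign_add p he0] at h
    refine mul_right_cancel₀ (pow_ne_zero r (neg_ne_zero.2 one_ne_zero)) (h.symm.trans ?_)
    rw [hr]
    ring
  obtain ⟨g, hg, hg0, hgm, hgV⟩ := hN m (by omega) hmsign
  have hne : l * (r : ℤ) ≠ k * ((g.natDegree + p.natDegree : ℕ) : ℤ) := by
    intro h
    have h' := congrArg Int.natAbs h
    rw [Int.natAbs_mul, Int.natAbs_mul, Int.natAbs_natCast, Int.natAbs_natCast] at h'
    have := Nat.le_mul_of_pos_left (g.natDegree + p.natDegree) (Int.natAbs_pos.2 hk)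
    omega
  obtain ⟨hL0, hLdeg⟩ := natDegree_lieSymbol hp hf0 hg0 k l hne
  refine ⟨_, lieSymbol_mem_skewPoly he0 hpc hf hg, hL0, by omega, ?_⟩
  rw [← opMul_lie_opMul]
  exact hVW _ hgV

open Polynomial in
lemma hasLargeDegrees_DpmGrade_zero {p : ℂ[X]} (hp : p ≠ 0) (c e : ℂ) :
    HasLargeDegrees p c e 0 (DpmGrade p c e 0) := by
  refine ⟨0, fun d _ hd => ?_⟩
  have hmem : (X - C (c / 2)) ^ d ∈ skewPoly p c e 0 := by
    intro x
    have hsq : ((-1 : ℂ) ^ d) * (-1) ^ d = 1 := by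
      rw [← mul_pow]; norm_num
    have hg : gradeSign p e 0 = -(-1) ^ d := by rw [hd, neg_neg]
    simp only [eval_pow, eval_sub, eval_X, eval_C, hg, Int.cast_zero]
    rw [show c - 0 - x - c / 2 = (-1) * (x - c / 2) by ring, mul_pow]
    linear_combination (-(x - c / 2) ^ d) * hsq
  refine ⟨_, hmem, pow_ne_zero _ (X_sub_C_ne_zero _), by simp, ?_⟩
  rw [DpmGrade_eq_map hp]
  exact Submodule.mem_map_of_mem hmem

theorem nonzero_deg_neg_one_nondegenerate (p : Polynomial ℂ) (hp : p ≠ 0) (c : ℂ)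
    (hpc : ∀ x : ℂ, p.eval x = (-1 : ℂ) ^ p.natDegree * p.eval (-x + c))
    (e : ℂ) (he : e = 1 ∨ e = -1)
    (a : Module.End ℂ LaurentV) (ha : a ∈ DpmGrade p c e (-1)) (ha0 : a ≠ 0) :
    ∀ j : ℕ, FinCodimIn (M := Module.End ℂ LaurentV) (paNeg p c e a j) (DpmGrade p c e (-(j : ℤ) - 1)) := by
  rw [DpmGrade_eq_map hp] at ha
  obtain ⟨b, hb, rfl⟩ := ha
  have hb0 : b ≠ 0 := by
    rintro rfl
    simp at ha0
  have hone : HasLargeDegrees p c e (-1) (paOne p c e (opMul p (-1) b)) :=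
    (hasLargeDegrees_DpmGrade_zero hp c e).lie hp he hpc (k := -1) (by norm_num) hb hb0
      fun y hy => Submodule.subset_span (IterBracket.step _ y .base hy)
  intro j
  refine HasLargeDegrees.finCodimIn hp he ?_
  induction j with
  | zero => simpa [paNeg] using hone
  | succ j ih =>
    obtain ⟨g, hg, hg0, hgV⟩ := ih.exists_ne_zero he
    have := hone.lie (W := paNeg p c e (opMul p (-1) b) (j + 1)) hp he hpc
      (k := -(j : ℤ) - 1) (by omega) hg hg0 fun y hy => by
        have hswap : ⁅opMul p (-(j : ℤ) - 1) g, y⁆ = (-1 : ℂ) • ⁅y, opMul p (-(j : ℤ) - 1) g⁆ :=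
          LinearMap.ext fun v => by simp [Ring.lie_def]
        rw [hswap]
        exact Submodule.smul_mem _ _ (Submodule.subset_span ⟨y, hy, _, hgV, rfl⟩)
    rwa [show -((j + 1 : ℕ) : ℤ) - 1 = -(j : ℤ) - 1 + -1 by push_cast; ring]

end
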